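/- Let n ≥ 1, N = {1,…,n}, ν : 𝒫(N) → ℝ with ν(∅) = 0, i ∈ N, and K ≥ 1. For the SVARM estimator φ̂_i = φ̂_i⁺ − φ̂_i⁻ built from one warm-up sample per sign and K i.i.d. main samples per sign, it holds that E[φ̂_i] = φ_i (Theorem 4.1, unbiasedness of SVARM). -/

import Mathlib

open Finset
open scoped Classical

noncomputable section

/-- The `n`-th harmonic number `Hₙ = ∑_{k=1}^n 1/k`. -/
def harm (n : ℕ) : ℝ := ∑ k ∈ Finset.range n, (1 : ℝ) / (k + 1)

/-- The player set `N_i = N \ {i}`. -/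
def Ni (n : ℕ) (i : Fin n) : Finset (Fin n) := Finset.univ.erase i

/-- The Shapley weights `w_S = 1/(n·C(n−1,|S|))` (defining `P^w` on subsets of `N_i`). -/
def wgt (n : ℕ) (S : Finset (Fin n)) : ℝ :=
  1 / ((n : ℝ) * (Nat.choose (n - 1) S.card : ℝ))

/-- The SVARM sampling distribution `P⁺(S) = 1/(|S|·C(n,|S|)·Hₙ)` on nonempty `S ⊆ N`
(the formula evaluates to `0` on `S = ∅` by division-by-zero conventions). -/
def Pplus (n : ℕ) (S : Finset (Fin n)) : ℝ :=
  1 / ((S.card : ℝ) * (Nat.choose n S.card : ℝ) * harm n)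

/-- The SVARM sampling distribution `P⁻(S) = 1/((n−|S|)·C(n,|S|)·Hₙ)` on proper `S ⊊ N`
(the formula evaluates to `0` on `S = N` by division-by-zero conventions). -/
def Pminus (n : ℕ) (S : Finset (Fin n)) : ℝ :=
  1 / (((n : ℝ) - (S.card : ℝ)) * (Nat.choose n S.card : ℝ) * harm n)

/-- Sample space of SVARM with `K` main-loop pairs: warm-up samples `B⁺, B⁻` and main
samples `A₁⁺,…,A_K⁺`, `A₁⁻,…,A_K⁻`. -/
abbrev Omega (n K : ℕ) :=
  Finset (Fin n) × Finset (Fin n) × (Fin K → Finset (Fin n)) × (Fin K → Finset (Fin n))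

/-- Joint pmf of the mutually independent samples `B⁺, B⁻ ∼ P^w` (subsets of `N_i`),
`A₁⁺,…,A_K⁺` i.i.d. `∼ P⁺` and `A₁⁻,…,A_K⁻` i.i.d. `∼ P⁻`. -/
def jointP (n K : ℕ) (i : Fin n) (ω : Omega n K) : ℝ :=
  (if ω.1 ⊆ Ni n i then wgt n ω.1 else 0) *
    (if ω.2.1 ⊆ Ni n i then wgt n ω.2.1 else 0) *
    (∏ k, Pplus n (ω.2.2.1 k)) * (∏ k, Pminus n (ω.2.2.2 k))

/-- Expectation with respect to the joint distribution of the SVARM samples. -/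
def expVal (n K : ℕ) (i : Fin n) (f : Omega n K → ℝ) : ℝ :=
  ∑ ω : Omega n K, jointP n K i ω * f ω

/-- Probability of an event under the joint distribution of the SVARM samples. -/
def probEvent (n K : ℕ) (i : Fin n) (E : Omega n K → Prop) : ℝ :=
  ∑ ω : Omega n K, if E ω then jointP n K i ω else 0

/-- The sample count `m_i⁺ = 1 + #{k : i ∈ A_k⁺}`. -/
def mplus (n K : ℕ) (i : Fin n) (ω : Omega n K) : ℕ :=
  1 + (Finset.univ.filter fun k => i ∈ ω.2.2.1 k).card

/-- The sample count `m_i⁻ = 1 + #{k : i ∉ A_k⁻}`. -/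
def mminus (n K : ℕ) (i : Fin n) (ω : Omega n K) : ℕ :=
  1 + (Finset.univ.filter fun k => i ∉ ω.2.2.2 k).card

/-- The estimate `φ̂_i⁺ = (ν(B⁺ ∪ {i}) + ∑_{k : i ∈ A_k⁺} ν(A_k⁺))/m_i⁺`. -/
def phiHatPlus (n K : ℕ) (ν : Finset (Fin n) → ℝ) (i : Fin n) (ω : Omega n K) : ℝ :=
  (ν (insert i ω.1) + ∑ k ∈ Finset.univ.filter (fun k => i ∈ ω.2.2.1 k), ν (ω.2.2.1 k)) /
    (mplus n K i ω : ℝ)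

/-- The estimate `φ̂_i⁻ = (ν(B⁻) + ∑_{k : i ∉ A_k⁻} ν(A_k⁻))/m_i⁻`. -/
def phiHatMinus (n K : ℕ) (ν : Finset (Fin n) → ℝ) (i : Fin n) (ω : Omega n K) : ℝ :=
  (ν ω.2.1 + ∑ k ∈ Finset.univ.filter (fun k => i ∉ ω.2.2.2 k), ν (ω.2.2.2 k)) /
    (mminus n K i ω : ℝ)

/-- The SVARM estimator `φ̂_i = φ̂_i⁺ − φ̂_i⁻`. -/
def phiHat (n K : ℕ) (ν : Finset (Fin n) → ℝ) (i : Fin n) (ω : Omega n K) : ℝ :=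
  phiHatPlus n K ν i ω - phiHatMinus n K ν i ω

/-- The Shapley value `φ_i = ∑_{S ⊆ N_i} w_S (ν(S∪{i}) − ν(S))`. -/
def shapley (n : ℕ) (ν : Finset (Fin n) → ℝ) (i : Fin n) : ℝ :=
  ∑ S ∈ (Ni n i).powerset, wgt n S * (ν (insert i S) - ν S)

/-- The positive Shapley value `φ_i⁺ = E[ν(A ∪ {i})]` for `A ∼ P^w`. -/
def phiPlus (n : ℕ) (ν : Finset (Fin n) → ℝ) (i : Fin n) : ℝ :=
  ∑ S ∈ (Ni n i).powerset, wgt n S * ν (insert i S)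

/-- The negative Shapley value `φ_i⁻ = E[ν(A)]` for `A ∼ P^w`. -/
def phiMinus (n : ℕ) (ν : Finset (Fin n) → ℝ) (i : Fin n) : ℝ :=
  ∑ S ∈ (Ni n i).powerset, wgt n S * ν S

/-- The variance `σ_i⁺² = Var[ν(A ∪ {i})]` for `A ∼ P^w`. -/
def sigPlusSq (n : ℕ) (ν : Finset (Fin n) → ℝ) (i : Fin n) : ℝ :=
  ∑ S ∈ (Ni n i).powerset, wgt n S * (ν (insert i S) - phiPlus n ν i) ^ 2

/-- The variance `σ_i⁻² = Var[ν(A)]` for `A ∼ P^w`. -/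
def sigMinusSq (n : ℕ) (ν : Finset (Fin n) → ℝ) (i : Fin n) : ℝ :=
  ∑ S ∈ (Ni n i).powerset, wgt n S * (ν S - phiMinus n ν i) ^ 2

end

/-- The conditionally centred part of a random-size sample average has zero mean: weighting the sum
of the centred accepted samples by any function of their number gives total mass zero. -/
theorem sum_prod_mul_centered_accepted_eq_zero {α : Type*} [Fintype α] (p : α → ℝ)
    (q : α → Prop) [DecidablePred q] (g : α → ℝ)
    (hg : ∑ a, (if q a then p a * g a else 0) = 0) (K : ℕ) (h : ℕ → ℝ) :
    ∑ A : Fin K → α, (∏ k, p (A k)) *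
      ((∑ k ∈ univ.filter (fun k => q (A k)), g (A k)) *
        h (univ.filter (fun k => q (A k))).card) = 0 := by
  induction K generalizing h with
  | zero => simp
  | succ K ih =>
    simp only [Finset.sum_filter, Finset.card_filter] at ih ⊢
    rw [← (Fin.consEquiv fun _ : Fin (K + 1) => α).sum_comp, Fintype.sum_prod_type]
    simp only [Fin.consEquiv_apply, Fin.prod_univ_succ, Fin.sum_univ_succ, Fin.cons_zero,
      Fin.cons_succ]
    have split (a : α) (A : Fin K → α) :
        p a * (∏ k, p (A k)) *
          (((if q a then g a else 0) + ∑ k, if q (A k) then g (A k) else 0) *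
            h ((if q a then 1 else 0) + ∑ k, if q (A k) then 1 else 0)) =
        (if q a then p a * g a else 0) *
          ((∏ k, p (A k)) * h (1 + ∑ k, if q (A k) then 1 else 0)) +
        p a * ((∏ k, p (A k)) * ((∑ k, if q (A k) then g (A k) else 0) *
          h ((if q a then 1 else 0) + ∑ k, if q (A k) then 1 else 0))) := by
      split_ifs <;> ring
    simp only [split, Finset.sum_add_distrib, ← Finset.mul_sum]
    rw [← Finset.sum_mul, hg, zero_mul, zero_add]
    refine Finset.sum_eq_zero fun a _ => ?_
    rw [ih fun m => h ((if q a then 1 else 0) + m), mul_zero]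

/-- Independent draws from a weight of total mass one have joint mass one. -/
theorem sum_prod_eq_one {α : Type*} [Fintype α] (p : α → ℝ) (hp : ∑ a, p a = 1) (K : ℕ) :
    ∑ A : Fin K → α, ∏ k, p (A k) = 1 := by
  rw [← Fintype.piFinset_univ, ← Finset.prod_univ_sum (fun _ => univ) fun _ => p]
  simp [hp]

/-- A sample average over one warm-up draw with mean `φ` and the accepted ones among `K` independent
draws, whose mean conditional on acceptance is also `φ`, is an unbiased estimate of `φ`. -/
theorem sum_warmup_average_eq {α β : Type*} [Fintype α] [Fintype β] (w f : β → ℝ) (p : α → ℝ)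
    (q : α → Prop) [DecidablePred q] (g : α → ℝ) (φ : ℝ) (hw : ∑ b, w b = 1)
    (hf : ∑ b, w b * f b = φ) (hp : ∑ a, p a = 1)
    (hg : ∑ a, (if q a then p a * (g a - φ) else 0) = 0) (K : ℕ) :
    ∑ b, w b * ∑ A : Fin K → α, (∏ k, p (A k)) *
      ((f b + ∑ k ∈ univ.filter (fun k => q (A k)), g (A k)) /
        ((1 + (univ.filter (fun k => q (A k))).card : ℕ) : ℝ)) = φ := by
  have split (b : β) (A : Fin K → α) :
      (∏ k, p (A k)) * ((f b + ∑ k ∈ univ.filter (fun k => q (A k)), g (A k)) /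
        ((1 + (univ.filter (fun k => q (A k))).card : ℕ) : ℝ)) =
      (f b - φ) * ((∏ k, p (A k)) *
        ((1 + (univ.filter (fun k => q (A k))).card : ℕ) : ℝ)⁻¹) +
      (∏ k, p (A k)) * ((∑ k ∈ univ.filter (fun k => q (A k)), (g (A k) - φ)) *
        ((1 + (univ.filter (fun k => q (A k))).card : ℕ) : ℝ)⁻¹) + φ * ∏ k, p (A k) := by
    rw [Finset.sum_sub_distrib, Finset.sum_const, nsmul_eq_mul]
    have : ((1 + (univ.filter (fun k => q (A k))).card : ℕ) : ℝ) ≠ 0 := by positivity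
    field_simp
    push_cast
    ring
  simp only [split, Finset.sum_add_distrib, ← Finset.mul_sum]
  rw [sum_prod_mul_centered_accepted_eq_zero p q (fun a => g a - φ) hg K
    fun m => ((1 + m : ℕ) : ℝ)⁻¹, sum_prod_eq_one p hp]
  simp only [add_zero, mul_one, mul_add, Finset.sum_add_distrib, ← Finset.sum_mul, ← mul_assoc, hw,
    mul_sub, Finset.sum_sub_distrib, hf]
  ring

theorem harm_pos {n : ℕ} (hn : 1 ≤ n) : 0 < harm n :=
  Finset.sum_pos (fun _ _ => by positivity) ⟨0, Finset.mem_range.mpr hn⟩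

theorem sum_Pplus {n : ℕ} (hn : 1 ≤ n) : ∑ S, Pplus n S = 1 := by
  have h := Finset.sum_powerset_apply_card (x := (univ : Finset (Fin n)))
    (fun m => 1 / ((m : ℝ) * (n.choose m : ℝ) * harm n))
  rw [Finset.powerset_univ, Finset.card_univ, Fintype.card_fin] at h
  simp only [Pplus]
  rw [h, Finset.sum_range_succ']
  have hH := (harm_pos hn).ne'
  have key : ∀ m ∈ Finset.range n, n.choose (m + 1) •
      (1 / (((m + 1 : ℕ) : ℝ) * (n.choose (m + 1) : ℝ) * harm n)) =
      1 / ((m : ℝ) + 1) * (harm n)⁻¹ := by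
    intro m hm
    have hc : (n.choose (m + 1) : ℝ) ≠ 0 := by
      exact_mod_cast (Nat.choose_pos (Finset.mem_range.mp hm)).ne'
    have hm' : (m : ℝ) + 1 ≠ 0 := by positivity
    rw [nsmul_eq_mul]
    push_cast
    field_simp
  rw [Finset.sum_congr rfl key, ← Finset.sum_mul]
  simpa [harm] using mul_inv_cancel₀ hH

theorem Pminus_eq_Pplus_compl (n : ℕ) (S : Finset (Fin n)) : Pminus n S = Pplus n Sᶜ := by
  have hS : S.card ≤ n := by simpa using S.card_le_univ
  simp [Pminus, Pplus, Finset.card_compl, Nat.cast_sub hS, Nat.choose_symm hS]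

theorem sum_Pminus {n : ℕ} (hn : 1 ≤ n) : ∑ S, Pminus n S = 1 := by
  simp only [Pminus_eq_Pplus_compl]
  rw [← sum_Pplus hn]
  exact (Equiv.mk compl compl compl_compl compl_compl).sum_comp (Pplus n)

theorem card_Ni (n : ℕ) (i : Fin n) : (Ni n i).card = n - 1 := by
  simp [Ni, Finset.card_erase_of_mem]

theorem sum_wgt {n : ℕ} (hn : 1 ≤ n) (i : Fin n) : ∑ S ∈ (Ni n i).powerset, wgt n S = 1 := by
  have h := Finset.sum_powerset_apply_card (x := Ni n i)
    (fun m => 1 / ((n : ℝ) * ((n - 1).choose m : ℝ)))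
  rw [card_Ni, Nat.sub_add_cancel hn] at h
  simp only [wgt]
  rw [h]
  have hn' : (n : ℝ) ≠ 0 := by positivity
  have key : ∀ m ∈ Finset.range n, (n - 1).choose m •
      (1 / ((n : ℝ) * ((n - 1).choose m : ℝ))) = 1 / (n : ℝ) := by
    intro m hm
    have hc : ((n - 1).choose m : ℝ) ≠ 0 := by
      exact_mod_cast (Nat.choose_pos (Nat.le_sub_one_of_lt (Finset.mem_range.mp hm))).ne'
    rw [nsmul_eq_mul]
    field_simp
  rw [Finset.sum_congr rfl key]
  simp [hn']

theorem subset_Ni_iff {n : ℕ} {i : Fin n} {S : Finset (Fin n)} : S ⊆ Ni n i ↔ i ∉ S := by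
  simp [Ni, Finset.subset_erase]

/-- Conditioned on containing `i`, the distribution `P⁺` is that of `B ∪ {i}` with `B ∼ P^w`. -/
theorem Pplus_insert {n : ℕ} (hn : 1 ≤ n) {i : Fin n} {S : Finset (Fin n)} (hS : i ∉ S) :
    Pplus n (insert i S) = wgt n S * (harm n)⁻¹ := by
  obtain ⟨m, rfl⟩ := Nat.exists_eq_add_of_le' hn
  have h := Nat.add_one_mul_choose_eq m S.card
  have h' : ((m + 1 : ℕ) : ℝ) * (m.choose S.card : ℝ) =
      ((S.card + 1 : ℕ) : ℝ) * ((m + 1).choose (S.card + 1) : ℝ) := by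
    rw [mul_comm ((S.card + 1 : ℕ) : ℝ)]
    exact_mod_cast h
  rw [Pplus, wgt, Finset.card_insert_of_notMem hS, Nat.add_sub_cancel, h', ← one_div,
    one_div_mul_one_div]

/-- Conditioned on not containing `i`, the distribution `P⁻` is `P^w`. -/
theorem Pminus_eq_wgt_mul {n : ℕ} (hn : 1 ≤ n) {i : Fin n} {S : Finset (Fin n)} (hS : i ∉ S) :
    Pminus n S = wgt n S * (harm n)⁻¹ := by
  obtain ⟨m, rfl⟩ := Nat.exists_eq_add_of_le' hn
  have hc : S.card ≤ m := by
    simpa [card_Ni] using Finset.card_le_card (subset_Ni_iff.mpr hS)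
  have h := Nat.choose_mul_succ_eq m S.card
  have h' : ((m + 1 : ℕ) : ℝ) * (m.choose S.card : ℝ) =
      (((m + 1 : ℕ) : ℝ) - (S.card : ℝ)) * ((m + 1).choose S.card : ℝ) := by
    rw [← Nat.cast_sub (by omega), mul_comm, mul_comm (((m + 1 - S.card : ℕ)) : ℝ)]
    exact_mod_cast h
  rw [Pminus, wgt, Nat.add_sub_cancel, h', ← one_div, one_div_mul_one_div]

theorem sum_ite_subset_Ni {n : ℕ} (i : Fin n) (f : Finset (Fin n) → ℝ) :
    ∑ S, (if S ⊆ Ni n i then f S else 0) = ∑ S ∈ (Ni n i).powerset, f S := by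
  rw [← Finset.sum_filter]
  congr 1
  ext S
  simp

theorem sum_ite_mem {n : ℕ} (i : Fin n) (f : Finset (Fin n) → ℝ) :
    ∑ S, (if i ∈ S then f S else 0) = ∑ S ∈ (Ni n i).powerset, f (insert i S) := by
  rw [← Finset.sum_filter]
  refine Finset.sum_nbij' (fun S => S.erase i) (insert i) ?_ ?_ ?_ ?_ ?_ <;>
    simp +contextual [subset_Ni_iff]

theorem sum_Pplus_centered {n : ℕ} (hn : 1 ≤ n) (ν : Finset (Fin n) → ℝ) (i : Fin n) :
    ∑ S, (if i ∈ S then Pplus n S * (ν S - phiPlus n ν i) else 0) = 0 := by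
  have key : ∀ S ∈ (Ni n i).powerset,
      Pplus n (insert i S) * (ν (insert i S) - phiPlus n ν i) =
      (harm n)⁻¹ * (wgt n S * ν (insert i S) - wgt n S * phiPlus n ν i) := by
    intro S hS
    rw [Pplus_insert hn (subset_Ni_iff.mp (Finset.mem_powerset.mp hS))]
    ring
  rw [sum_ite_mem i fun S => Pplus n S * (ν S - phiPlus n ν i), Finset.sum_congr rfl key,
    ← Finset.mul_sum, Finset.sum_sub_distrib, ← Finset.sum_mul, sum_wgt hn, phiPlus]
  ring

theorem sum_Pminus_centered {n : ℕ} (hn : 1 ≤ n) (ν : Finset (Fin n) → ℝ) (i : Fin n) :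
    ∑ S, (if i ∉ S then Pminus n S * (ν S - phiMinus n ν i) else 0) = 0 := by
  have key : ∀ S ∈ (Ni n i).powerset,
      Pminus n S * (ν S - phiMinus n ν i) =
      (harm n)⁻¹ * (wgt n S * ν S - wgt n S * phiMinus n ν i) := by
    intro S hS
    rw [Pminus_eq_wgt_mul hn (subset_Ni_iff.mp (Finset.mem_powerset.mp hS))]
    ring
  simp only [← subset_Ni_iff]
  rw [sum_ite_subset_Ni i fun S => Pminus n S * (ν S - phiMinus n ν i),
    Finset.sum_congr rfl key,
    ← Finset.mul_sum, Finset.sum_sub_distrib, ← Finset.sum_mul, sum_wgt hn, phiMinus]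
  ring

theorem sum_warmup_mass {n : ℕ} (hn : 1 ≤ n) (i : Fin n) :
    ∑ S, (if S ⊆ Ni n i then wgt n S else 0) = 1 := by
  rw [sum_ite_subset_Ni, sum_wgt hn]

theorem expVal_phiHatPlus {n : ℕ} (hn : 1 ≤ n) (K : ℕ) (ν : Finset (Fin n) → ℝ) (i : Fin n) :
    expVal n K i (phiHatPlus n K ν i) = phiPlus n ν i := by
  refine Eq.trans ?_ (sum_warmup_average_eq (fun S => if S ⊆ Ni n i then wgt n S else 0)
    (fun S => ν (insert i S)) (Pplus n) (fun S => i ∈ S) ν (phiPlus n ν i)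
    (sum_warmup_mass hn i) (by simp only [ite_mul, zero_mul]; exact sum_ite_subset_Ni i _)
    (sum_Pplus hn) (sum_Pplus_centered hn ν i) K)
  have hB := sum_warmup_mass hn i
  have hA := sum_prod_eq_one (Pminus n) (sum_Pminus hn) K
  simp only [expVal, jointP, phiHatPlus, mplus, Fintype.sum_prod_type]
  refine Finset.sum_congr rfl fun B _ => ?_
  simp only [mul_assoc, ← Finset.mul_sum]
  congr 1
  rw [← Finset.sum_mul, hB, one_mul]
  simp only [← Finset.sum_mul, hA, one_mul]

theorem expVal_phiHatMinus {n : ℕ} (hn : 1 ≤ n) (K : ℕ) (ν : Finset (Fin n) → ℝ) (i : Fin n) :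
    expVal n K i (phiHatMinus n K ν i) = phiMinus n ν i := by
  refine Eq.trans ?_ (sum_warmup_average_eq (fun S => if S ⊆ Ni n i then wgt n S else 0)
    ν (Pminus n) (fun S => i ∉ S) ν (phiMinus n ν i)
    (sum_warmup_mass hn i) (by simp only [ite_mul, zero_mul]; exact sum_ite_subset_Ni i _)
    (sum_Pminus hn) (sum_Pminus_centered hn ν i) K)
  have hB := sum_warmup_mass hn i
  have hA := sum_prod_eq_one (Pplus n) (sum_Pplus hn) K
  simp only [expVal, jointP, phiHatMinus, mminus, Fintype.sum_prod_type]
  simp only [mul_assoc, ← Finset.mul_sum]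
  simp only [← Finset.sum_mul, hA, hB, one_mul]

/-- Theorem 4.1 (unbiasedness of SVARM): `E[φ̂_i] = φ_i`. -/
theorem stmt8 (n K : ℕ) (hn : 1 ≤ n) (hK : 1 ≤ K) (ν : Finset (Fin n) → ℝ)
    (hν : ν ∅ = 0) (i : Fin n) :
    expVal n K i (phiHat n K ν i) = shapley n ν i := by
  have hsub : expVal n K i (phiHat n K ν i) =
      expVal n K i (phiHatPlus n K ν i) - expVal n K i (phiHatMinus n K ν i) := by
    simp only [expVal, phiHat, mul_sub, Finset.sum_sub_distrib]
  rw [hsub, expVal_phiHatPlus hn, expVal_phiHatMinus hn]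
  simp only [shapley, phiPlus, phiMinus, mul_sub, Finset.sum_sub_distrib]
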